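/- arXiv:0809.3702 — 3 statements merged into one kernel-verified Lean document; each statement's English description precedes it below -/
import Mathlib

section
/- Let X_1, ..., X_n be square integrable random variables on the classical Wiener space. Then the n-fold Wick product X_1 ⋄ ··· ⋄ X_n satisfies ‖X_1 ⋄ ··· ⋄ X_n‖_{L²(P)} ≤ ‖Γ(√n)X_1‖_{L²(P)} ··· ‖Γ(√n)X_n‖_{L²(P)} (in particular, if each right-hand factor is finite then the Wick product lies in L²(P)). -/
open MeasureTheory ProbabilityTheory Filter Topology
open scoped ENNReal NNReal

noncomputable section

namespace WickPaper

/-- Lebesgue measure on the cube `[0,T]^n`. -/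
def boxMeasure (T : ℝ) (n : ℕ) : Measure (Fin n → ℝ) :=
  Measure.pi fun _ => (volume : Measure ℝ).restrict (Set.Icc 0 T)

instance (T : ℝ) (n : ℕ) : IsFiniteMeasure (boxMeasure T n) := by
  unfold boxMeasure; infer_instance

/-- `L²([0,T]^n)`. -/
abbrev Ker (T : ℝ) (n : ℕ) := Lp ℝ 2 (boxMeasure T n)

/-- A formal Wiener–Itô chaos series: the sequence of its kernels. -/
abbrev Chaos (T : ℝ) := (n : ℕ) → Ker T n

/-- A kernel is symmetric if it is invariant (a.e.) under permutations of its variables. -/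
def IsSymmKer {T : ℝ} {n : ℕ} (h : Ker T n) : Prop :=
  ∀ σ : Equiv.Perm (Fin n),
    (fun x : Fin n → ℝ => (h : (Fin n → ℝ) → ℝ) (x ∘ σ)) =ᵐ[boxMeasure T n]
      (h : (Fin n → ℝ) → ℝ)

/-- The (possibly infinite) squared `L²(P)`-norm `Σ_n n! |c_n|²` of a chaos series. -/
def chaosNorm2 {T : ℝ} (c : Chaos T) : ℝ≥0∞ :=
  ∑' n : ℕ, (Nat.factorial n : ℝ≥0∞) * (‖c n‖₊ : ℝ≥0∞) ^ 2

/-- A chaos series represents a square-integrable random variable iff `Σ_n n! |c_n|² < ∞`. -/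
def ChaosL2 {T : ℝ} (c : Chaos T) : Prop := chaosNorm2 c < ⊤

/-- The second quantization operator `Γ(λ)` on chaos series:  `(Γ(λ)c)_n = λ^n c_n`. -/
def Gam {T : ℝ} (lam : ℝ) (c : Chaos T) : Chaos T := fun n => lam ^ n • c n

/-- Transport of kernels along an equality of orders. -/
def kerCast {T : ℝ} {j n : ℕ} (h : j = n) (f : Ker T j) : Ker T n := h ▸ f

/-- The sample space of the classical Wiener space over `[0,T]`: continuous paths. -/
abbrev PathSpace (T : ℝ) := C(Set.Icc (0 : ℝ) T, ℝ)

instance (T : ℝ) : MeasurableSpace (PathSpace T) := borel _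

instance (T : ℝ) : BorelSpace (PathSpace T) := ⟨rfl⟩

/-- The classical Wiener space over `[0,T]`, together with its Wiener–Itô chaos machinery:
`P` is the Wiener measure (the coordinate process is a Brownian motion), `I n` is the `n`-th
order multiple Itô integral, `kernels X` is the (unique, symmetric) sequence of kernels in the
Wiener–Itô chaos decomposition of `X`, and `stp` is the symmetrized tensor product of kernels. -/
structure WienerSpace (T : ℝ) where
  T_pos : 0 < T
  /-- the Wiener measure -/
  P : Measure (PathSpace T)
  probP : IsProbabilityMeasure P
  /-- the coordinate process starts at `0` -/
  coord_start : ∀ᵐ ω ∂P, ω ⟨0, Set.left_mem_Icc.mpr T_pos.le⟩ = 0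
  /-- increments of the coordinate process are centered Gaussian -/
  coord_gauss : ∀ s t : Set.Icc (0 : ℝ) T, (s : ℝ) ≤ t →
    Measure.map (fun ω : PathSpace T => ω t - ω s) P = gaussianReal 0 ((t : ℝ) - s).toNNReal
  /-- increments of the coordinate process over disjoint intervals are independent -/
  coord_indep : ∀ (n : ℕ) (t : Fin (n + 1) → Set.Icc (0 : ℝ) T),
    Monotone (fun i => (t i : ℝ)) →
    iIndepFun (m := fun _ => Real.measurableSpace)
      (fun (i : Fin n) (ω : PathSpace T) => ω (t i.succ) - ω (t i.castSucc)) P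
  /-- the `n`-th order multiple Itô integral -/
  I : (n : ℕ) → Ker T n → Lp ℝ 2 P
  I_linear : ∀ n : ℕ, IsLinearMap ℝ (I n)
  /-- `I 0` of a kernel is the corresponding constant -/
  I_zero : ∀ h : Ker T 0,
    (I 0 h : PathSpace T → ℝ) =ᵐ[P] fun _ => ∫ x, h x ∂boxMeasure T 0
  /-- `I 1` is the Wiener integral: it is a centered Gaussian with variance `|h|²` -/
  I_one_gauss : ∀ h : Ker T 1,
    Measure.map (I 1 h : PathSpace T → ℝ) P = gaussianReal 0 (‖h‖₊ ^ 2)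
  /-- multiple Itô integrals of order `≥ 1` are centered -/
  I_mean_zero : ∀ n : ℕ, 1 ≤ n → ∀ h : Ker T n, ∫ ω, (I n h) ω ∂P = 0
  /-- the Itô isometry on symmetric kernels: `‖I_n(h)‖ = √(n!) |h|` -/
  I_norm : ∀ (n : ℕ) (h : Ker T n), IsSymmKer h →
    ‖I n h‖ = Real.sqrt (Nat.factorial n) * ‖h‖
  /-- homogeneous chaoses of different orders are orthogonal -/
  I_orth : ∀ {m n : ℕ}, m ≠ n → ∀ (h : Ker T m) (g : Ker T n),
    inner ℝ (I m h) (I n g) = (0 : ℝ)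
  /-- the kernels of the Wiener–Itô chaos decomposition of a square integrable `X` -/
  kernels : Lp ℝ 2 P → Chaos T
  kernels_symm : ∀ (X : Lp ℝ 2 P) (n : ℕ), IsSymmKer (kernels X n)
  /-- the chaos decomposition: `X = Σ_n I_n(h_n)` -/
  kernels_hasSum : ∀ X : Lp ℝ 2 P, HasSum (fun n => I n (kernels X n)) X
  /-- uniqueness of the chaos decomposition -/
  kernels_unique : ∀ (X : Lp ℝ 2 P) (c : Chaos T), (∀ n, IsSymmKer (c n)) →
    HasSum (fun n => I n (c n)) X → c = kernels X
  /-- `‖X‖² = Σ_n n! |h_n|²` -/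
  norm_eq : ∀ X : Lp ℝ 2 P, (‖X‖₊ : ℝ≥0∞) ^ 2 = chaosNorm2 (kernels X)
  /-- the symmetrized tensor product `⊗̂` of kernels -/
  stp : ∀ {j m : ℕ}, Ker T j → Ker T m → Ker T (j + m)
  stp_spec : ∀ {j m : ℕ} (h : Ker T j) (g : Ker T m),
    (stp h g : (Fin (j + m) → ℝ) → ℝ) =ᵐ[boxMeasure T (j + m)]
      fun x => ((Nat.factorial (j + m) : ℝ))⁻¹ *
        ∑ σ : Equiv.Perm (Fin (j + m)),
          h (fun i => x (σ (Fin.castAdd m i))) * g (fun i => x (σ (Fin.natAdd j i)))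
  /-- the `n`-fold tensor power `h^{⊗n}` of a one-variable kernel -/
  tpow : Ker T 1 → (n : ℕ) → Ker T n
  tpow_spec : ∀ (h : Ker T 1) (n : ℕ),
    (tpow h n : (Fin n → ℝ) → ℝ) =ᵐ[boxMeasure T n] fun x => ∏ i, h (fun _ => x i)

namespace WienerSpace

variable {T : ℝ}

/-- `Z ∈ L²(P)` is the random variable with chaos decomposition `c`, i.e. `Z = Σ_n I_n(c_n)`. -/
def Represents (S : WienerSpace T) (c : Chaos T) (Z : Lp ℝ 2 S.P) : Prop :=
  HasSum (fun n => S.I n (c n)) Z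

/-- The Wick product of two chaos series: `(c ⋄ d)_n = Σ_{j=0}^n c_j ⊗̂ d_{n-j}`. -/
def wickKer (S : WienerSpace T) (c d : Chaos T) : Chaos T := fun n =>
  ∑ j ∈ (Finset.range (n + 1)).attach,
    kerCast (Nat.add_sub_cancel' (Nat.lt_succ_iff.mp (Finset.mem_range.mp j.2)))
      (S.stp (c j) (d (n - j)))

/-- The constant kernel `1` of order `0`. -/
def oneKer (T : ℝ) : Ker T 0 :=
  (memLp_const (1 : ℝ) : MemLp (fun _ : Fin 0 → ℝ => (1 : ℝ)) 2 (boxMeasure T 0)).toLp _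

/-- The chaos series of the constant random variable `1`. -/
def unitChaos (T : ℝ) : Chaos T := fun n =>
  if h : 0 = n then kerCast h (oneKer T) else 0

/-- Wick powers `c^{⋄n}` (with `c^{⋄0} = 1`). -/
def wickPow (S : WienerSpace T) (c : Chaos T) : ℕ → Chaos T
  | 0 => unitChaos T
  | n + 1 => S.wickKer (S.wickPow c n) c

/-- The `n`-fold Wick product `c 0 ⋄ ⋯ ⋄ c (n-1)`. -/
def wickFold (S : WienerSpace T) {n : ℕ} (c : Fin n → Chaos T) : Chaos T :=
  (List.ofFn c).foldr S.wickKer (unitChaos T)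

/-- The stochastic exponential `ℰ(h) = exp{∫₀^T h dB − ½∫₀^T h² ds}`, where `∫₀^T h dB = I_1(h)`
is the Wiener integral of `h` and `∫₀^T h² ds = ‖h‖²`. -/
def stochExp (S : WienerSpace T) (h : Ker T 1) : PathSpace T → ℝ := fun ω =>
  Real.exp ((S.I 1 h : PathSpace T → ℝ) ω - ‖h‖ ^ 2 / 2)

/-- The stochastic exponential with purely imaginary argument:
`ℰ(ih) = exp{i ∫₀^T h dB − ½∫₀^T (ih)² ds} = exp{i I_1(h) + ‖h‖²/2}`. -/
def stochExpI (S : WienerSpace T) (h : Ker T 1) : PathSpace T → ℂ := fun ω =>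
  Complex.exp (Complex.I * ((S.I 1 h : PathSpace T → ℝ) ω : ℂ) + (‖h‖ : ℂ) ^ 2 / 2)

/-- The Ornstein–Uhlenbeck semigroup:
`(P_t X)(ω) = ∫ X(e^{−t} ω + √(1 − e^{−2t}) ω̃) dP(ω̃)`. -/
def ou (S : WienerSpace T) (t : ℝ) (X : PathSpace T → ℝ) : PathSpace T → ℝ := fun ω =>
  ∫ ω' : PathSpace T,
    X (Real.exp (-t) • ω + Real.sqrt (1 - Real.exp (-2 * t)) • ω') ∂S.P

end WienerSpace

/-- Convergence in distribution of real random variables on a measure space towards a law `ν`,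
tested against bounded continuous functions. -/
def TendstoInDistribution {α : Type*} [MeasurableSpace α] (P : Measure α)
    (Xn : ℕ → α → ℝ) (ν : Measure ℝ) : Prop :=
  ∀ f : BoundedContinuousFunction ℝ ℝ,
    Tendsto (fun n => ∫ ω, f (Xn n ω) ∂P) atTop (𝓝 (∫ x, f x ∂ν))

/-- Positive definiteness of a complex-valued function on `L²([0,T])`. -/
def PosDefFn {T : ℝ} (φ : Ker T 1 → ℂ) : Prop :=
  ∀ (n : ℕ) (h : Fin n → Ker T 1) (c : Fin n → ℂ),
    0 ≤ (∑ i, ∑ j, c i * (starRingEnd ℂ) (c j) * φ (h i - h j)).re ∧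
      (∑ i, ∑ j, c i * (starRingEnd ℂ) (c j) * φ (h i - h j)).im = 0

end WickPaper

namespace WickPaper
theorem measurePreserving_reindex (T : ℝ) {n : ℕ} {ι : Type} [Fintype ι] (e : ι ≃ Fin n) :
    MeasurePreserving (fun x : Fin n → ℝ => fun i => x (e i)) (boxMeasure T n)
      (Measure.pi fun _ : ι => (volume : Measure ℝ).restrict (Set.Icc 0 T)) := by
  have h := (measurePreserving_piCongrLeft
    (fun _ : Fin n => (volume : Measure ℝ).restrict (Set.Icc 0 T)) e).symm
  exact h

theorem measurePreserving_split (T : ℝ) (j m : ℕ) (σ : Equiv.Perm (Fin (j + m))) :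
    MeasurePreserving (fun x : Fin (j + m) → ℝ =>
      ((fun i : Fin j => x (σ (Fin.castAdd m i))), (fun i : Fin m => x (σ (Fin.natAdd j i)))))
      (boxMeasure T (j + m)) ((boxMeasure T j).prod (boxMeasure T m)) := by
  have h1 := measurePreserving_reindex T (finSumFinEquiv.trans σ : Fin j ⊕ Fin m ≃ Fin (j+m))
  have h2 := measurePreserving_sumPiEquivProdPi
    (fun _ : Fin j ⊕ Fin m => (volume : Measure ℝ).restrict (Set.Icc 0 T))
  exact h2.comp h1

theorem isSymm_stp {T : ℝ} (S : WienerSpace T) {j m : ℕ} (h : Ker T j) (g : Ker T m) :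
    IsSymmKer (S.stp h g) := by
  intro τ
  have hs := S.stp_spec h g
  have hq := (measurePreserving_reindex T τ).quasiMeasurePreserving.ae_eq_comp hs
  refine hq.trans (EventuallyEq.trans ?_ hs.symm)
  refine Eventually.of_forall fun x => ?_
  simp only [Function.comp]
  congr 1
  exact Fintype.sum_equiv (Equiv.mulLeft τ) _ _ (fun σ => by simp)

theorem isSymm_cast {T : ℝ} {j n : ℕ} (h : j = n) (f : Ker T j) (hf : IsSymmKer f) :
    IsSymmKer (kerCast h f) := by
  subst h; exact hf

theorem isSymm_zero {T : ℝ} {n : ℕ} : IsSymmKer (0 : Ker T n) := by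
  intro τ
  have hs := Lp.coeFn_zero ℝ 2 (boxMeasure T n)
  have hq := (measurePreserving_reindex T τ).quasiMeasurePreserving.ae_eq_comp hs
  exact hq.trans (EventuallyEq.trans (Eventually.of_forall fun x => rfl) hs.symm)

theorem isSymm_add {T : ℝ} {n : ℕ} {f g : Ker T n} (hf : IsSymmKer f) (hg : IsSymmKer g) :
    IsSymmKer (f + g) := by
  intro τ
  have hs := Lp.coeFn_add f g
  have hq := (measurePreserving_reindex T τ).quasiMeasurePreserving.ae_eq_comp hs
  exact hq.trans (EventuallyEq.trans ((hf τ).add (hg τ)) hs.symm)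

theorem isSymm_wick {T : ℝ} (S : WienerSpace T) (c d : Chaos T) (n : ℕ) :
    IsSymmKer (S.wickKer c d n) := by
  unfold WienerSpace.wickKer
  exact Finset.sum_induction _ IsSymmKer (fun _ _ => isSymm_add) isSymm_zero
    fun j _ => isSymm_cast _ _ (isSymm_stp S _ _)

theorem norm_cast_ker {T : ℝ} {j n : ℕ} (h : j = n) (f : Ker T j) :
    ‖kerCast h f‖₊ = ‖f‖₊ := by
  subst h; rfl

theorem isSymm_represents {T : ℝ} (S : WienerSpace T) (c : Chaos T) (hc : ∀ n, IsSymmKer (c n))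
    (h2 : ChaosL2 c) : ∃ Z, S.Represents c Z := by
  let L : (n : ℕ) → Ker T n →ₗ[ℝ] Lp ℝ 2 S.P := fun n => (S.I_linear n).mk'
  let V : ℕ → Submodule ℝ (Lp ℝ 2 S.P) := fun n => LinearMap.range (L n)
  have hV : OrthogonalFamily ℝ (fun n => V n) fun n => (V n).subtypeₗᵢ := by
    rintro i j hij ⟨_, v, rfl⟩ ⟨_, w, rfl⟩
    exact S.I_orth hij v w
  have hs := (hV.summable_iff_norm_sq_summable (fun n => ⟨L n (c n), c n, rfl⟩)).2 (by
    have h3 : ∀ n, ‖(⟨L n (c n), c n, rfl⟩ : V n)‖ ^ 2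
        = (((Nat.factorial n : ℝ≥0) * ‖c n‖₊ ^ 2 : ℝ≥0) : ℝ) := by
      intro n
      have : ‖(⟨L n (c n), c n, rfl⟩ : V n)‖ = ‖S.I n (c n)‖ := rfl
      rw [this, S.I_norm n _ (hc n), mul_pow, Real.sq_sqrt (by positivity)]
      push_cast
      rfl
    simp_rw [h3]
    rw [NNReal.summable_coe, ← ENNReal.tsum_coe_ne_top_iff_summable]
    have := h2.ne
    unfold chaosNorm2 at this
    push_cast
    exact this)
  exact ⟨_, hs.hasSum⟩

theorem norm_stp_le {T : ℝ} (S : WienerSpace T) {j m : ℕ} (h : Ker T j) (g : Ker T m) :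
    ‖S.stp h g‖₊ ≤ ‖h‖₊ * ‖g‖₊ := by
  have key : eLpNorm (S.stp h g) 2 (boxMeasure T (j + m)) ≤
      eLpNorm h 2 (boxMeasure T j) * eLpNorm g 2 (boxMeasure T m) := by
    rw [eLpNorm_congr_ae (S.stp_spec h g)]
    have hF : AEStronglyMeasurable (fun p : (Fin j → ℝ) × (Fin m → ℝ) => h p.1 * g p.2)
        ((boxMeasure T j).prod (boxMeasure T m)) :=
      (Lp.aestronglyMeasurable h).comp_fst.mul (Lp.aestronglyMeasurable g).comp_snd
    have hFn : eLpNorm (fun p : (Fin j → ℝ) × (Fin m → ℝ) => h p.1 * g p.2) 2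
        ((boxMeasure T j).prod (boxMeasure T m)) =
        eLpNorm h 2 (boxMeasure T j) * eLpNorm g 2 (boxMeasure T m) := by
      rw [eLpNorm_eq_lintegral_rpow_enorm_toReal (by norm_num) (by norm_num),
        eLpNorm_eq_lintegral_rpow_enorm_toReal (by norm_num) (by norm_num),
        eLpNorm_eq_lintegral_rpow_enorm_toReal (by norm_num) (by norm_num),
        ← ENNReal.mul_rpow_of_nonneg _ _ (by norm_num), ← lintegral_prod_mul]
      · simp [enorm_mul, mul_pow]
      · exact (Lp.aestronglyMeasurable h).enorm.pow_const _
      · exact (Lp.aestronglyMeasurable g).enorm.pow_const _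
    have h1 : ∀ σ : Equiv.Perm (Fin (j + m)),
        AEStronglyMeasurable (fun x : Fin (j + m) → ℝ =>
          h (fun i => x (σ (Fin.castAdd m i))) * g (fun i => x (σ (Fin.natAdd j i))))
          (boxMeasure T (j + m)) := fun σ =>
      hF.comp_measurePreserving (measurePreserving_split T j m σ)
    have h2 : ∀ σ : Equiv.Perm (Fin (j + m)),
        eLpNorm (fun x : Fin (j + m) → ℝ =>
          h (fun i => x (σ (Fin.castAdd m i))) * g (fun i => x (σ (Fin.natAdd j i)))) 2
          (boxMeasure T (j + m)) = eLpNorm h 2 (boxMeasure T j) * eLpNorm g 2 (boxMeasure T m) :=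
      fun σ => (eLpNorm_comp_measurePreserving hF (measurePreserving_split T j m σ)).trans hFn
    have h3 := eLpNorm_sum_le (p := 2) (s := (Finset.univ : Finset (Equiv.Perm (Fin (j + m)))))
      (fun σ _ => h1 σ) (by norm_num)
    simp_rw [h2] at h3
    have h4 := eLpNorm_const_smul (((Nat.factorial (j + m) : ℝ))⁻¹)
      (∑ σ : Equiv.Perm (Fin (j + m)), fun x : Fin (j + m) → ℝ =>
          h (fun i => x (σ (Fin.castAdd m i))) * g (fun i => x (σ (Fin.natAdd j i))))
      2 (boxMeasure T (j + m))
    have h5 : (fun x : Fin (j + m) → ℝ => ((Nat.factorial (j + m) : ℝ))⁻¹ *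
        ∑ σ : Equiv.Perm (Fin (j + m)),
          h (fun i => x (σ (Fin.castAdd m i))) * g (fun i => x (σ (Fin.natAdd j i)))) =
        (((Nat.factorial (j + m) : ℝ))⁻¹) • (∑ σ : Equiv.Perm (Fin (j + m)),
          fun x : Fin (j + m) → ℝ =>
          h (fun i => x (σ (Fin.castAdd m i))) * g (fun i => x (σ (Fin.natAdd j i)))) := by
      ext x; simp
    rw [h5, h4]
    refine (mul_le_mul_right h3 _).trans ?_
    rw [Finset.sum_const, Finset.card_univ, Fintype.card_perm, Fintype.card_fin, nsmul_eq_mul,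
      ← mul_assoc]
    refine (mul_le_mul_left (le_of_eq ?_) _).trans (one_mul _).le
    have hp : ((Nat.factorial (j + m) : ℕ) : ℝ) ≠ 0 := by positivity
    rw [enorm_inv hp]
    have : ‖((Nat.factorial (j + m) : ℕ) : ℝ)‖ₑ = (Nat.factorial (j + m) : ℝ≥0∞) := by
      simp
    rw [this]
    exact ENNReal.inv_mul_cancel (by simp [Nat.factorial_ne_zero]) (by simp)
  have e := fun (k : ℕ) (f : Ker T k) => Lp.enorm_def f
  rw [← e, ← e, ← e, enorm_eq_nnnorm, enorm_eq_nnnorm, enorm_eq_nnnorm] at key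
  exact_mod_cast key

end WickPaper

namespace WickPaper

/-- Weighted squared norm `Σ n! r^n a_n²` of a sequence of kernel norms. -/
def wNorm (r : ℝ≥0) (a : ℕ → ℝ≥0) : ℝ≥0∞ :=
  ∑' n : ℕ, (((Nat.factorial n : ℝ≥0) * r ^ n * a n ^ 2 : ℝ≥0) : ℝ≥0∞)

theorem ennreal_cauchy_prod (f g : ℕ → ℝ≥0∞) :
    (∑' n, f n) * ∑' n, g n = ∑' n, ∑ p ∈ Finset.HasAntidiagonal.antidiagonal n, f p.1 * g p.2 := by
  have h1 : (∑' n, f n) * ∑' n, g n = ∑' p : ℕ × ℕ, f p.1 * g p.2 := by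
    rw [ENNReal.tsum_prod (f := fun a b => f a * g b), ← ENNReal.tsum_mul_right]
    simp_rw [ENNReal.tsum_mul_left]
  rw [h1, ← Finset.HasAntidiagonal.sigmaAntidiagonalEquivProd.tsum_eq, ENNReal.tsum_sigma']
  refine tsum_congr fun n => ?_
  rw [tsum_fintype]
  exact Finset.sum_coe_sort (Finset.HasAntidiagonal.antidiagonal n) (fun p : ℕ × ℕ => f p.1 * g p.2)

theorem binom_inv (u v : ℝ≥0) (huv : u⁻¹ + v⁻¹ = 1) (n : ℕ) :
    (Nat.factorial n : ℝ≥0) * ∑ p ∈ Finset.HasAntidiagonal.antidiagonal n,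
      ((Nat.factorial p.1 : ℝ≥0) * u ^ p.1 * ((Nat.factorial p.2 : ℝ≥0) * v ^ p.2))⁻¹ = 1 := by
  have h := (Commute.all u⁻¹ v⁻¹).add_pow' n
  rw [huv, one_pow] at h
  rw [h, Finset.mul_sum]
  refine Finset.sum_congr rfl fun p hp => ?_
  have hp' := Finset.HasAntidiagonal.mem_antidiagonal.1 hp
  subst hp'
  have hc : ((p.1 + p.2).choose p.1 : ℝ≥0) * (Nat.factorial p.1) * (Nat.factorial p.2)
      = Nat.factorial (p.1 + p.2) := by
    rw [Nat.choose_symm_add]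
    exact_mod_cast Nat.add_choose_mul_factorial_mul_factorial p.1 p.2
  have h1 : (Nat.factorial p.1 : ℝ≥0) ≠ 0 := by positivity
  have h2 : (Nat.factorial p.2 : ℝ≥0) ≠ 0 := by positivity
  rw [← hc, nsmul_eq_mul, mul_inv, mul_inv, mul_inv, inv_pow, inv_pow]
  field_simp

theorem wNorm_conv_le (r u v : ℝ≥0) (hu : u ≠ 0) (hv : v ≠ 0) (huv : u⁻¹ + v⁻¹ = 1)
    (a b w : ℕ → ℝ≥0)
    (hw : ∀ n, w n ≤ ∑ p ∈ Finset.HasAntidiagonal.antidiagonal n, a p.1 * b p.2) :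
    wNorm r w ≤ wNorm (u * r) a * wNorm (v * r) b := by
  unfold wNorm
  rw [ennreal_cauchy_prod]
  refine ENNReal.tsum_le_tsum fun n => ?_
  simp_rw [← ENNReal.coe_mul]
  rw [← ENNReal.ofNNReal_finsetSum, ENNReal.coe_le_coe]
  have cs := Finset.sum_sq_le_sum_mul_sum_of_sq_le_mul (Finset.HasAntidiagonal.antidiagonal n)
    (r := fun p => a p.1 * b p.2)
    (f := fun p => ((Nat.factorial p.1 : ℝ≥0) * u ^ p.1 *
      ((Nat.factorial p.2 : ℝ≥0) * v ^ p.2))⁻¹)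
    (g := fun p => ((Nat.factorial p.1 : ℝ≥0) * u ^ p.1 * ((Nat.factorial p.2 : ℝ≥0) * v ^ p.2))
      * (a p.1 * b p.2) ^ 2) (fun _ _ => zero_le) (fun _ _ => zero_le)
    (fun p _ => by
      have h1 : (Nat.factorial p.1 : ℝ≥0) ≠ 0 := by positivity
      have h2 : (Nat.factorial p.2 : ℝ≥0) ≠ 0 := by positivity
      rw [inv_mul_cancel_left₀]
      positivity)
  calc (Nat.factorial n : ℝ≥0) * r ^ n * w n ^ 2
      ≤ (Nat.factorial n : ℝ≥0) * r ^ n * (∑ p ∈ Finset.HasAntidiagonal.antidiagonal n, a p.1 * b p.2) ^ 2 := by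
        gcongr; exact hw n
    _ ≤ (Nat.factorial n : ℝ≥0) * r ^ n * _ := mul_le_mul_right cs _
    _ = r ^ n * ∑ p ∈ Finset.HasAntidiagonal.antidiagonal n,
        ((Nat.factorial p.1 : ℝ≥0) * u ^ p.1 * ((Nat.factorial p.2 : ℝ≥0) * v ^ p.2))
      * (a p.1 * b p.2) ^ 2 := by
        have := binom_inv u v huv n
        rw [mul_comm (Nat.factorial n : ℝ≥0), mul_assoc, ← mul_assoc (Nat.factorial n : ℝ≥0),
          this, one_mul]
    _ ≤ _ := by
        rw [Finset.mul_sum]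
        refine le_of_eq (Finset.sum_congr rfl fun p hp => ?_)
        rw [← Finset.HasAntidiagonal.mem_antidiagonal.1 hp]
        ring

theorem norm_wick_le {T : ℝ} (S : WienerSpace T) (c d : Chaos T) (n : ℕ) :
    ‖S.wickKer c d n‖₊ ≤ ∑ p ∈ Finset.HasAntidiagonal.antidiagonal n, ‖c p.1‖₊ * ‖d p.2‖₊ := by
  rw [Finset.Nat.sum_antidiagonal_eq_sum_range_succ (fun i j => ‖c i‖₊ * ‖d j‖₊),
    ← Finset.sum_attach]
  refine (nnnorm_sum_le _ _).trans (Finset.sum_le_sum fun j _ => ?_)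
  rw [norm_cast_ker]
  exact norm_stp_le S _ _

theorem norm_oneKer (T : ℝ) : ‖WienerSpace.oneKer T‖₊ = 1 := by
  have h : boxMeasure T 0 Set.univ = 1 := by
    unfold boxMeasure; simp
  have h2 : ‖WienerSpace.oneKer T‖ = 1 := by
    unfold WienerSpace.oneKer
    rw [Lp.norm_toLp, eLpNorm_const _ (by norm_num) (by
      intro h0; rw [h0] at h; simp at h), h]
    simp
  exact NNReal.eq h2

theorem norm_unit (T : ℝ) (n : ℕ) :
    ‖WienerSpace.unitChaos T n‖₊ = if n = 0 then 1 else 0 := by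
  unfold WienerSpace.unitChaos
  rcases Nat.eq_zero_or_pos n with h | h
  · subst h; simp [norm_cast_ker, norm_oneKer]
  · simp [h.ne, h.ne']

theorem wNorm_foldr_le {T : ℝ} (S : WienerSpace T) (l : List (Chaos T)) (r : ℝ≥0) :
    wNorm r (fun n => ‖l.foldr S.wickKer (WienerSpace.unitChaos T) n‖₊) ≤
      (l.map fun c => wNorm (l.length * r) fun n => ‖c n‖₊).prod := by
  induction l generalizing r with
  | nil =>
    simp only [List.foldr_nil, List.map_nil, List.prod_nil]
    unfold wNorm
    rw [tsum_eq_single 0]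
    · simp [norm_unit]
    · intro n hn; simp [norm_unit, hn]
  | cons c l ih =>
    rcases Nat.eq_zero_or_pos l.length with h0 | hk
    · obtain rfl := List.length_eq_zero_iff.1 h0
      simp only [List.foldr_cons, List.foldr_nil, List.map_cons, List.map_nil, List.prod_cons,
        List.prod_nil, mul_one, List.length_cons, List.length_nil, zero_add, Nat.cast_one, one_mul]
      unfold wNorm
      refine ENNReal.tsum_le_tsum fun n => ?_
      rw [ENNReal.coe_le_coe]
      gcongr
      refine (norm_wick_le S _ _ n).trans ?_
      rw [Finset.sum_eq_single (n, 0)]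
      · simp [norm_unit]
      · intro p hp hne
        have : p.2 ≠ 0 := by
          intro h; apply hne; have := Finset.HasAntidiagonal.mem_antidiagonal.1 hp
          ext <;> simp <;> omega
        simp [norm_unit, this]
      · intro h; exact absurd (by simp) h
    · have hk' : (l.length : ℝ≥0) ≠ 0 := by exact_mod_cast hk.ne'
      have h1 : ((l.length : ℝ≥0) + 1) ≠ 0 := by positivity
      have key := wNorm_conv_le r (l.length + 1) ((l.length + 1) / l.length) h1
        (div_ne_zero h1 hk') (by rw [inv_div]; field_simp; try ring)
        (fun n => ‖c n‖₊) (fun n => ‖l.foldr S.wickKer (WienerSpace.unitChaos T) n‖₊)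
        (fun n => ‖(c :: l).foldr S.wickKer (WienerSpace.unitChaos T) n‖₊)
        (fun n => norm_wick_le S _ _ n)
      refine key.trans ?_
      rw [List.map_cons, List.prod_cons]
      have e : (l.length : ℝ≥0) * ((l.length + 1) / l.length * r) = (c :: l).length * r := by
        rw [List.length_cons, ← mul_assoc, mul_div_cancel₀ _ hk']; push_cast; rfl
      have ih' := ih ((l.length + 1) / l.length * r)
      rw [e] at ih'
      have e2 : (((c :: l).length : ℕ) : ℝ≥0) = l.length + 1 := by simp
      rw [e2] at ih' ⊢
      gcongr

theorem chaosNorm2_eq {T : ℝ} (c : Chaos T) : chaosNorm2 c = wNorm 1 fun n => ‖c n‖₊ := by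
  unfold chaosNorm2 wNorm
  simp

theorem chaosNorm2_gam {T : ℝ} (k : ℕ) (c : Chaos T) :
    chaosNorm2 (Gam (Real.sqrt k) c) = wNorm k fun n => ‖c n‖₊ := by
  unfold chaosNorm2 wNorm Gam
  refine tsum_congr fun n => ?_
  have h : ‖Real.sqrt k‖₊ ^ 2 = (k : ℝ≥0) := by
    apply NNReal.eq; simp
  rw [nnnorm_smul, nnnorm_pow]
  have : (‖Real.sqrt k‖₊ ^ n * ‖c n‖₊) ^ 2 = (k : ℝ≥0) ^ n * ‖c n‖₊ ^ 2 := by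
    rw [← h]; ring
  rw [← ENNReal.coe_pow, this]
  push_cast
  ring

end WickPaper
namespace WickPaper

/-- Theorem 2.1. For square integrable `X_1, …, X_n` on the classical Wiener
space, `‖X_1 ⋄ ⋯ ⋄ X_n‖ ≤ ‖Γ(√n)X_1‖ ⋯ ‖Γ(√n)X_n‖` (the possibly infinite `L²`-norms being
computed from the chaos kernels); in particular, if every factor on the right is finite then the
Wick product lies in `L²(P)`. -/
theorem wick_product_norm_bound {T : ℝ} (S : WienerSpace T) (n : ℕ) (hn : 1 ≤ n)
    (X : Fin n → Lp ℝ 2 S.P) :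
    chaosNorm2 (S.wickFold fun i => S.kernels (X i)) ^ (1 / 2 : ℝ) ≤
      (∏ i, chaosNorm2 (Gam (Real.sqrt n) (S.kernels (X i))) ^ (1 / 2 : ℝ)) ∧
    ((∀ i, ChaosL2 (Gam (Real.sqrt n) (S.kernels (X i)))) →
      ∃ Z : Lp ℝ 2 S.P, S.Represents (S.wickFold fun i => S.kernels (X i)) Z) := by
  have hb : chaosNorm2 (S.wickFold fun i => S.kernels (X i)) ≤
      ∏ i, chaosNorm2 (Gam (Real.sqrt n) (S.kernels (X i))) := by
    have h := wNorm_foldr_le S (List.ofFn fun i => S.kernels (X i)) 1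
    rw [List.map_ofFn, List.prod_ofFn, List.length_ofFn, mul_one] at h
    rw [chaosNorm2_eq]
    refine h.trans (le_of_eq (Finset.prod_congr rfl fun i _ => ?_))
    rw [chaosNorm2_gam]
    rfl
  refine ⟨?_, fun hfin => ?_⟩
  · rw [ENNReal.prod_rpow_of_nonneg (by norm_num)]
    exact ENNReal.rpow_le_rpow hb (by norm_num)
  · refine isSymm_represents S _ (fun k => ?_) (hb.trans_lt ?_)
    · obtain ⟨m, rfl⟩ : ∃ m, n = m + 1 := ⟨n - 1, by omega⟩
      unfold WienerSpace.wickFold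
      rw [List.ofFn_succ, List.foldr_cons]
      exact isSymm_wick S _ _ k
    · exact ENNReal.prod_lt_top fun i _ => hfin i

end WickPaper
end
end

section
/- Let X ∈ L²(P) with E[X] = 0. Suppose there exists a sequence of real numbers (a_n)_{n≥1} such that Γ(a_n) X^{⋄n} ∈ L²(P) for every n ≥ 1 and Γ(a_n) X^{⋄n} converges in the strong topology of L²(P) as n → ∞. Then the limit must be zero. -/
open MeasureTheory ProbabilityTheory Filter Topology
open scoped ENNReal NNReal

noncomputable section

namespace WickPaper

theorem qmp_left {T : ℝ} {j m : ℕ} (σ : Equiv.Perm (Fin (j + m))) :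
    Measure.QuasiMeasurePreserving
      (fun (x : Fin (j + m) → ℝ) (i : Fin j) => x (σ (Fin.castAdd m i)))
      (boxMeasure T (j + m)) (boxMeasure T j) := by
  have h1 := (measurePreserving_piCongrLeft
    (fun _ : Fin (j + m) => (volume : Measure ℝ).restrict (Set.Icc 0 T))
    (finSumFinEquiv.trans σ)).symm
  have h2 := measurePreserving_sumPiEquivProdPi
    (fun _ : Fin j ⊕ Fin m => (volume : Measure ℝ).restrict (Set.Icc 0 T))
  exact Measure.quasiMeasurePreserving_fst.comp (h2.comp h1).quasiMeasurePreserving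

theorem qmp_right {T : ℝ} {j m : ℕ} (σ : Equiv.Perm (Fin (j + m))) :
    Measure.QuasiMeasurePreserving
      (fun (x : Fin (j + m) → ℝ) (i : Fin m) => x (σ (Fin.natAdd j i)))
      (boxMeasure T (j + m)) (boxMeasure T m) := by
  have h1 := (measurePreserving_piCongrLeft
    (fun _ : Fin (j + m) => (volume : Measure ℝ).restrict (Set.Icc 0 T))
    (finSumFinEquiv.trans σ)).symm
  have h2 := measurePreserving_sumPiEquivProdPi
    (fun _ : Fin j ⊕ Fin m => (volume : Measure ℝ).restrict (Set.Icc 0 T))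
  exact Measure.quasiMeasurePreserving_snd.comp (h2.comp h1).quasiMeasurePreserving

theorem stp_zero_left {T : ℝ} (S : WienerSpace T) {j m : ℕ} (h : Ker T j) (hh : h = 0)
    (g : Ker T m) : S.stp h g = 0 := by
  subst hh
  apply Lp.ext
  have key : ∀ᵐ x ∂boxMeasure T (j + m), ∀ σ : Equiv.Perm (Fin (j + m)),
      (0 : Ker T j) (fun i => x (σ (Fin.castAdd m i))) = 0 := by
    rw [ae_all_iff]
    intro σ
    exact (qmp_left σ).ae (Lp.coeFn_zero ℝ 2 (boxMeasure T j))
  filter_upwards [S.stp_spec (0 : Ker T j) g, key, Lp.coeFn_zero ℝ 2 (boxMeasure T (j + m))]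
    with x hx hk h0
  rw [hx, h0]
  simp only [hk]
  simp

theorem stp_zero_right {T : ℝ} (S : WienerSpace T) {j m : ℕ} (h : Ker T j)
    (g : Ker T m) (hg : g = 0) : S.stp h g = 0 := by
  subst hg
  apply Lp.ext
  have key : ∀ᵐ x ∂boxMeasure T (j + m), ∀ σ : Equiv.Perm (Fin (j + m)),
      (0 : Ker T m) (fun i => x (σ (Fin.natAdd j i))) = 0 := by
    rw [ae_all_iff]
    intro σ
    exact (qmp_right σ).ae (Lp.coeFn_zero ℝ 2 (boxMeasure T m))
  filter_upwards [S.stp_spec h (0 : Ker T m), key, Lp.coeFn_zero ℝ 2 (boxMeasure T (j + m))]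
    with x hx hk h0
  rw [hx, h0]
  simp only [hk]
  simp

theorem kerCast_zero {T : ℝ} {j n : ℕ} (h : j = n) : kerCast h (0 : Ker T j) = 0 := by
  subst h; rfl

theorem wickPow_eq_zero {T : ℝ} (S : WienerSpace T) (c : Chaos T) (hc : c 0 = 0) :
    ∀ n k : ℕ, k < n → S.wickPow c n k = 0 := by
  intro n
  induction n with
  | zero => intro k hk; omega
  | succ n ih =>
    intro k hk
    have hc' : ∀ m, m = 0 → c m = 0 := by rintro m rfl; exact hc
    change S.wickKer (S.wickPow c n) c k = 0
    unfold WienerSpace.wickKer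
    apply Finset.sum_eq_zero
    rintro ⟨j, hj⟩ -
    have hj' := Finset.mem_range.mp hj
    have : S.stp (S.wickPow c n j) (c (k - j)) = 0 := by
      by_cases h : j < n
      · exact stp_zero_left S _ (ih j h) _
      · exact stp_zero_right S _ _ (hc' _ (by omega))
    simp only [this]
    exact kerCast_zero _

theorem inner_hasSum {T : ℝ} (S : WienerSpace T) (c : Chaos T) (Z : Lp ℝ 2 S.P)
    (h : HasSum (fun n => S.I n (c n)) Z) (m : ℕ) (g : Ker T m) :
    inner ℝ (S.I m g) Z = inner ℝ (S.I m g) (S.I m (c m)) := by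
  have h1 := h.mapL (innerSL ℝ (S.I m g))
  have h2 := hasSum_single (f := fun n => innerSL ℝ (S.I m g) (S.I n (c n))) m
    (fun n hn => S.I_orth (Ne.symm hn) g (c n))
  exact h1.unique h2

theorem kernels_zero {T : ℝ} (S : WienerSpace T) (X : Lp ℝ 2 S.P)
    (hX : ∫ ω, X ω ∂S.P = 0) : S.kernels X 0 = 0 := by
  have h1 := inner_hasSum S _ X (S.kernels_hasSum X) 0 (S.kernels X 0)
  have h2 : inner ℝ (S.I 0 (S.kernels X 0)) X = 0 := by
    rw [L2.inner_def]
    have : ∀ᵐ ω ∂S.P, inner ℝ (S.I 0 (S.kernels X 0) ω) (X ω)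
        = (∫ x, S.kernels X 0 x ∂boxMeasure T 0) * X ω := by
      filter_upwards [S.I_zero (S.kernels X 0)] with ω hω
      rw [hω]
      simp [mul_comm]
    rw [integral_congr_ae this, integral_const_mul, hX, mul_zero]
  rw [h2] at h1
  have h3 : S.I 0 (S.kernels X 0) = 0 := inner_self_eq_zero.mp h1.symm
  have h4 := S.I_norm 0 _ (S.kernels_symm X 0)
  rw [h3] at h4
  simpa using h4.symm

/-- Theorem 3.3. Let `X ∈ L²(P)` with `E[X] = 0`. If for some sequence of real
numbers `(a_n)` the random variables `Γ(a_n) X^{⋄n}` belong to `L²(P)` for every `n ≥ 1` and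
converge strongly in `L²(P)`, then the limit must be zero. -/
theorem gamma_wick_power_limit_eq_zero {T : ℝ} (S : WienerSpace T) (X : Lp ℝ 2 S.P)
    (hX : ∫ ω, X ω ∂S.P = 0) (a : ℕ → ℝ) (Z : ℕ → Lp ℝ 2 S.P)
    (hZ : ∀ n : ℕ, 1 ≤ n → S.Represents (Gam (a n) (S.wickPow (S.kernels X) n)) (Z n))
    (L : Lp ℝ 2 S.P) (hL : Tendsto Z atTop (𝓝 L)) :
    L = 0 := by
  have hk := kernels_zero S X hX
  have horth : ∀ (m : ℕ) (g : Ker T m), inner ℝ (S.I m g) L = 0 := by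
    intro m g
    have ht : Tendsto (fun n => inner ℝ (S.I m g) (Z n)) atTop (𝓝 (inner ℝ (S.I m g) L)) :=
      tendsto_const_nhds.inner hL
    refine tendsto_nhds_unique ht (tendsto_const_nhds.congr' ?_)
    filter_upwards [eventually_gt_atTop m] with n hn
    rw [inner_hasSum S _ (Z n) (hZ n (by omega)) m g]
    have : Gam (a n) (S.wickPow (S.kernels X) n) m = 0 := by
      unfold Gam
      rw [wickPow_eq_zero S _ hk n m hn, smul_zero]
    rw [this, (S.I_linear m).map_zero, inner_zero_right]
  have h1 := (S.kernels_hasSum L).mapL (innerSL ℝ L)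
  have h2 : inner ℝ L L = (0 : ℝ) := by
    have h3 : (fun n => innerSL ℝ L (S.I n (S.kernels L n))) = fun _ : ℕ => (0 : ℝ) := by
      funext n
      change inner ℝ L (S.I n (S.kernels L n)) = (0 : ℝ)
      rw [real_inner_comm]
      exact horth _ _
    rw [h3] at h1
    exact h1.unique hasSum_zero
  exact inner_self_eq_zero.mp h2

end WickPaper
end
end

section
/- Let X ∈ L²(P) with E[X] = 1 and let h₁ ∈ L²([0,T]) be the first-order kernel in the chaos decomposition of X. Then lim_{n→∞} ‖Γ(√(2(n−1))/n) X‖_{L²(P)}^n = exp{|h₁|²_{L²([0,T])}}. -/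
open MeasureTheory ProbabilityTheory Filter Topology
open scoped ENNReal NNReal

noncomputable section

namespace WickPaper

theorem ana_limit (a : ℕ → ℝ) (ha : ∀ k, 0 ≤ a k) (hs : Summable a) (h0 : a 0 = 1) (u : ℕ → ℝ)
    (hu : ∀ n : ℕ, 2 ≤ n → u n = 2 * ((n : ℝ) - 1) / (n : ℝ) ^ 2) :
    Tendsto (fun n : ℕ => (∑' k, u n ^ k * a k) ^ n) atTop (𝓝 (Real.exp (2 * a 1))) := by
  have hinv : Tendsto (fun n : ℕ => ((n : ℝ))⁻¹) atTop (𝓝 0) := tendsto_inv_atTop_nhds_zero_nat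
  have hnu : Tendsto (fun n : ℕ => (n : ℝ) * u n) atTop (𝓝 2) := by
    have h : Tendsto (fun n : ℕ => 2 * (1 - ((n : ℝ))⁻¹)) atTop (𝓝 (2 * (1 - 0))) :=
      (hinv.const_sub 1).const_mul 2
    rw [sub_zero, mul_one] at h
    refine h.congr' ?_
    filter_upwards [eventually_ge_atTop 2] with n hn
    have : (n : ℝ) ≠ 0 := by positivity
    rw [hu n hn]; field_simp
  have hu0 : Tendsto u atTop (𝓝 0) := by
    have h := hnu.mul hinv
    rw [mul_zero] at h
    refine h.congr' ?_
    filter_upwards [eventually_ge_atTop 2] with n hn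
    have : (n : ℝ) ≠ 0 := by positivity
    field_simp
  have hunn : ∀ n : ℕ, 2 ≤ n → 0 ≤ u n ∧ u n ≤ 1 := by
    intro n hn
    have h2 : (2 : ℝ) ≤ n := by exact_mod_cast hn
    rw [hu n hn]
    refine ⟨div_nonneg (by linarith) (by positivity), ?_⟩
    rw [div_le_one (by positivity)]
    nlinarith [sq_nonneg ((n : ℝ) - 1)]
  have hsum : ∀ n : ℕ, 2 ≤ n → Summable (fun k => u n ^ k * a k) := by
    intro n hn
    obtain ⟨h1, h2⟩ := hunn n hn
    refine Summable.of_nonneg_of_le (fun k => mul_nonneg (pow_nonneg h1 k) (ha k)) (fun k => ?_) hs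
    exact mul_le_of_le_one_left (ha k) (pow_le_one₀ h1 h2)
  set R : ℕ → ℝ := fun n => ∑' k, u n ^ k * a (k + 2) with hR
  have hs2 : Summable (fun k => a (k + 2)) := (summable_nat_add_iff 2).2 hs
  have hsR : ∀ n : ℕ, 2 ≤ n → Summable (fun k => u n ^ k * a (k + 2)) := by
    intro n hn
    obtain ⟨h1, h2⟩ := hunn n hn
    refine Summable.of_nonneg_of_le (fun k => mul_nonneg (pow_nonneg h1 k) (ha _)) (fun k => ?_) hs2
    exact mul_le_of_le_one_left (ha _) (pow_le_one₀ h1 h2)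
  have hsplit : ∀ n : ℕ, 2 ≤ n → ∑' k, u n ^ k * a k = 1 + (u n * a 1 + u n ^ 2 * R n) := by
    intro n hn
    rw [← (hsum n hn).sum_add_tsum_nat_add 2, hR, ← tsum_mul_left]
    simp only [Finset.sum_range_succ, Finset.sum_range_zero, h0]
    have : ∀ k, u n ^ (k + 2) * a (k + 2) = u n ^ 2 * (u n ^ k * a (k + 2)) := fun k => by ring
    simp only [this]; ring
  have hRb : ∀ n : ℕ, 2 ≤ n → 0 ≤ R n ∧ R n ≤ ∑' k, a (k + 2) := by
    intro n hn
    obtain ⟨h1, h2⟩ := hunn n hn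
    exact ⟨tsum_nonneg fun k => mul_nonneg (pow_nonneg h1 k) (ha _),
      (hsR n hn).tsum_le_tsum (fun k => mul_le_of_le_one_left (ha _) (pow_le_one₀ h1 h2)) hs2⟩
  have huR : Tendsto (fun n => u n * R n) atTop (𝓝 0) := by
    have h := hu0.mul_const (∑' k, a (k + 2))
    rw [zero_mul] at h
    refine tendsto_of_tendsto_of_tendsto_of_le_of_le' tendsto_const_nhds h ?_ ?_
    · filter_upwards [eventually_ge_atTop 2] with n hn
      exact mul_nonneg (hunn n hn).1 (hRb n hn).1
    · filter_upwards [eventually_ge_atTop 2] with n hn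
      exact mul_le_mul_of_nonneg_left (hRb n hn).2 (hunn n hn).1
  have hmain : Tendsto (fun n : ℕ => (n : ℝ) * (u n * a 1 + u n ^ 2 * R n)) atTop
      (𝓝 (2 * a 1)) := by
    have h := (hnu.mul_const (a 1)).add (hnu.mul huR)
    rw [mul_zero, add_zero] at h
    refine h.congr fun n => by ring
  refine (Real.tendsto_one_add_pow_exp_of_tendsto hmain).congr' ?_
  filter_upwards [eventually_ge_atTop 2] with n hn
  rw [hsplit n hn]

theorem norm_kernel_zero {T : ℝ} (S : WienerSpace T) (X : Lp ℝ 2 S.P)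
    (hX : ∫ ω, X ω ∂S.P = 1) : ‖S.kernels X 0‖ = 1 := by
  have := S.probP
  have hn := S.I_norm 0 _ (S.kernels_symm X 0)
  simp only [Nat.factorial_zero, Nat.cast_one, Real.sqrt_one, one_mul] at hn
  have key : ∀ Y : Lp ℝ 2 S.P,
      inner ℝ (indicatorConstLp 2 MeasurableSet.univ (measure_ne_top S.P _) (1 : ℝ)) Y
        = ∫ ω, Y ω ∂S.P := by
    intro Y
    rw [L2.inner_indicatorConstLp_one, setIntegral_univ]
  have h1 := (S.kernels_hasSum X).mapL
    (innerSL ℝ (indicatorConstLp 2 MeasurableSet.univ (measure_ne_top S.P _) (1 : ℝ)))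
  simp only [innerSL_apply_apply, key] at h1
  have h2 := hasSum_single (f := fun n => ∫ ω, (S.I n (S.kernels X n)) ω ∂S.P) 0
    (fun n hn => S.I_mean_zero n (Nat.one_le_iff_ne_zero.2 hn) _)
  have h3 := h2.unique h1
  rw [hX] at h3
  have h4 := S.I_zero (S.kernels X 0)
  rw [integral_congr_ae h4] at h3
  simp at h3
  rw [h3] at h4
  rw [← hn, Lp.norm_def, eLpNorm_congr_ae h4]
  rw [eLpNorm_const _ two_ne_zero (IsProbabilityMeasure.ne_zero S.P)]
  simp

/-- Let `X ∈ L²(P)` with `E[X] = 1` and let `h₁` be the first-order kernel of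
`X`. Then `lim_{n→∞} ‖Γ(√(2(n−1))/n) X‖^n = exp{|h₁|²}` (the possibly infinite `L²`-norm being
computed from the chaos kernels). -/
theorem gamma_norm_pow_tendsto {T : ℝ} (S : WienerSpace T) (X : Lp ℝ 2 S.P)
    (hX : ∫ ω, X ω ∂S.P = 1) :
    Tendsto (fun n : ℕ =>
        (chaosNorm2 (Gam (Real.sqrt (2 * ((n : ℝ) - 1)) / n) (S.kernels X)) ^ (1 / 2 : ℝ)) ^ n)
      atTop (𝓝 (ENNReal.ofReal (Real.exp (‖S.kernels X 1‖ ^ 2)))) := by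
  have hfin : chaosNorm2 (S.kernels X) ≠ ⊤ := by
    rw [← S.norm_eq X]; exact ENNReal.pow_ne_top ENNReal.coe_ne_top
  have hterm : ∀ k, (Nat.factorial k : ℝ≥0∞) * (‖S.kernels X k‖₊ : ℝ≥0∞) ^ 2
      = ENNReal.ofReal ((Nat.factorial k : ℝ) * ‖S.kernels X k‖ ^ 2) := by
    intro k
    rw [ENNReal.ofReal_mul (by positivity), ENNReal.ofReal_natCast,
      ENNReal.ofReal_pow (norm_nonneg _), ofReal_norm, enorm_eq_nnnorm]
  set a : ℕ → ℝ := fun k => (Nat.factorial k : ℝ) * ‖S.kernels X k‖ ^ 2 with haa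
  have ha : ∀ k, 0 ≤ a k := fun k => by positivity
  have hs : Summable a := by
    have h : ∑' k, ENNReal.ofReal (a k) ≠ ⊤ := by
      simpa only [chaosNorm2, hterm] using hfin
    have h2 := ENNReal.summable_toReal h
    simpa only [ENNReal.toReal_ofReal (ha _)] using h2
  have h0 : a 0 = 1 := by simp [haa, norm_kernel_zero S X hX]
  have h1 : a 1 = ‖S.kernels X 1‖ ^ 2 := by simp [haa]
  have hu : ∀ n : ℕ, 2 ≤ n → (Real.sqrt (2 * ((n : ℝ) - 1)) / n) ^ 2
      = 2 * ((n : ℝ) - 1) / (n : ℝ) ^ 2 := by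
    intro n hn
    have h2 : (2 : ℝ) ≤ n := by exact_mod_cast hn
    rw [div_pow, Real.sq_sqrt (by linarith)]
  have hlim := ana_limit a ha hs h0 (fun n : ℕ => (Real.sqrt (2 * ((n : ℝ) - 1)) / n) ^ 2) hu
  have hlim2 := (ENNReal.tendsto_ofReal hlim).ennrpow_const (1 / 2 : ℝ)
  have hexp : ENNReal.ofReal (Real.exp (2 * a 1)) ^ (1 / 2 : ℝ)
      = ENNReal.ofReal (Real.exp (‖S.kernels X 1‖ ^ 2)) := by
    rw [ENNReal.ofReal_rpow_of_pos (Real.exp_pos _), ← Real.exp_mul, h1]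
    congr 2; ring
  rw [hexp] at hlim2
  refine hlim2.congr' ?_
  filter_upwards [eventually_ge_atTop 2] with n hn
  have hle : (Real.sqrt (2 * ((n : ℝ) - 1)) / n) ^ 2 ≤ 1 := by
    have h2 : (2 : ℝ) ≤ n := by exact_mod_cast hn
    rw [hu n hn, div_le_one (by positivity)]
    nlinarith [sq_nonneg ((n : ℝ) - 1)]
  generalize Real.sqrt (2 * ((n : ℝ) - 1)) / n = l at hle ⊢
  have hnn : ∀ k, 0 ≤ (l ^ 2) ^ k * a k := fun k => mul_nonneg (by positivity) (ha k)
  have hsl : Summable (fun k => (l ^ 2) ^ k * a k) :=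
    Summable.of_nonneg_of_le hnn
      (fun k => mul_le_of_le_one_left (ha k) (pow_le_one₀ (sq_nonneg l) hle)) hs
  have hG : chaosNorm2 (Gam l (S.kernels X)) = ENNReal.ofReal (∑' k, (l ^ 2) ^ k * a k) := by
    rw [ENNReal.ofReal_tsum_of_nonneg hnn hsl]
    unfold chaosNorm2 Gam
    refine tsum_congr fun k => ?_
    rw [← enorm_eq_nnnorm, ← ofReal_norm, ← ENNReal.ofReal_pow (norm_nonneg _),
      ← ENNReal.ofReal_natCast, ← ENNReal.ofReal_mul (by positivity), norm_smul, mul_pow,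
      Real.norm_eq_abs, sq_abs]
    congr 1
    simp only [haa]; ring
  rw [hG, ENNReal.ofReal_pow (tsum_nonneg hnn), ← ENNReal.rpow_natCast, ← ENNReal.rpow_natCast,
    ← ENNReal.rpow_mul, ← ENNReal.rpow_mul, mul_comm]

end WickPaper
end
end
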